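/- Let T : E → F be an order bounded linear operator (for all a, b ∈ E with a ≤ b there exist c, d ∈ F such that T maps the order interval [a,b] of E into the order interval [c,d] of F). Then there exists an order bounded linear operator S : G → F such that S(y) = T(y) for all y ∈ E. -/

import Mathlib

/-- A set `R` of pairs is a good cone if it is stable under sums and positive scaling,
and lies above zero over the origin. -/
def GoodCone {G F : Type*} [AddCommGroup G] [Module ℝ G] [Lattice F] [AddCommGroup F]
    [Module ℝ F] (R : Set (G × F)) : Prop :=
  (∀ p ∈ R, ∀ q ∈ R, p + q ∈ R) ∧ (∀ c : ℝ, 0 < c → ∀ p ∈ R, c • p ∈ R) ∧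
    ∀ f : F, ((0 : G), f) ∈ R → 0 ≤ f

theorem goodCone_extension {G F : Type*} [AddCommGroup G] [Module ℝ G]
    [ConditionallyCompleteLattice F] [AddCommGroup F] [Module ℝ F]
    [IsOrderedAddMonoid F] [PosSMulMono ℝ F]
    (R₀ : Set (G × F)) (h₀ : GoodCone R₀) (hne : ∀ x, ∃ f, (x, f) ∈ R₀) :
    ∃ S : G →ₗ[ℝ] F, ∀ x f, (x, f) ∈ R₀ → S x ≤ f := by
  obtain ⟨R, hsub, hmax⟩ := zorn_subset_nonempty {R : Set (G × F) | GoodCone R} (by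
    intro c hc hchain hcne
    refine ⟨⋃₀ c, ⟨?_, ?_, ?_⟩, fun s hs => Set.subset_sUnion_of_mem hs⟩
    · rintro p ⟨s, hs, hp⟩ q ⟨t, ht, hq⟩
      rcases hchain.total hs ht with h | h
      · exact ⟨t, ht, (hc ht).1 p (h hp) q hq⟩
      · exact ⟨s, hs, (hc hs).1 p hp q (h hq)⟩
    · rintro a ha p ⟨s, hs, hp⟩
      exact ⟨s, hs, (hc hs).2.1 a ha p hp⟩
    · rintro f ⟨s, hs, hp⟩
      exact (hc hs).2.2 f hp) R₀ h₀
  obtain ⟨hadd, hsmul, hpos⟩ : GoodCone R := hmax.prop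
  have hneR : ∀ x, ∃ f, (x, f) ∈ R := fun x => (hne x).imp fun f hf => hsub hf
  let A : G → Set F := fun x => {f | (x, f) ∈ R}
  have hbdd : ∀ x, BddBelow (A x) := by
    intro x
    obtain ⟨g, hg⟩ := hneR (-x)
    refine ⟨-g, fun f hf => ?_⟩
    have := hpos (f + g) (by simpa using hadd _ hf _ hg)
    exact neg_le_iff_add_nonneg.2 this
  let s : G → F := fun x => sInf (A x)
  have sle : ∀ x f, (x, f) ∈ R → s x ≤ f := fun x f h => csInf_le (hbdd x) h
  have les : ∀ x g, (∀ f, (x, f) ∈ R → g ≤ f) → g ≤ s x :=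
    fun x g h => le_csInf (hneR x) h
  have s_add : ∀ x y, s (x + y) ≤ s x + s y := by
    intro x y
    have h : ∀ f, (x, f) ∈ R → s (x + y) - f ≤ s y := fun f hf => les _ _ fun g hg => by
      rw [sub_le_iff_le_add']
      exact sle _ _ (hadd _ hf _ hg)
    have : s (x + y) - s y ≤ s x := les _ _ fun f hf => sub_le_comm.1 (h f hf)
    exact sub_le_iff_le_add.1 this
  have s_smul_le : ∀ (c : ℝ), 0 < c → ∀ x, s (c • x) ≤ c • s x := by
    intro c hc x
    have : c⁻¹ • s (c • x) ≤ s x := les _ _ fun f hf => by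
      have h1 := sle _ _ (hsmul c hc _ hf)
      have h2 := smul_le_smul_of_nonneg_left h1 (inv_pos.2 hc).le
      simpa [smul_smul, inv_mul_cancel₀ hc.ne'] using h2
    have h2 := smul_le_smul_of_nonneg_left this hc.le
    simpa [smul_smul, mul_inv_cancel₀ hc.ne'] using h2
  have s_smul : ∀ (c : ℝ), 0 < c → ∀ x, s (c • x) = c • s x := by
    intro c hc x
    refine le_antisymm (s_smul_le c hc x) ?_
    have h := s_smul_le c⁻¹ (inv_pos.2 hc) (c • x)
    have h2 := smul_le_smul_of_nonneg_left h hc.le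
    simpa [smul_smul, mul_inv_cancel₀ hc.ne', inv_mul_cancel₀ hc.ne'] using h2
  have s_zero : s 0 = 0 := by
    have h := s_smul 2 (by norm_num) 0
    rw [smul_zero, two_smul] at h
    simpa using h
  have s_neg_le : ∀ x, s (-x) ≤ - s x := by
    intro x
    let R' : Set (G × F) := {p | ∃ q ∈ R, ∃ t : ℝ, 0 ≤ t ∧ p = q + t • (-x, - s x)}
    have hR' : GoodCone R' := by
      refine ⟨?_, ?_, ?_⟩
      · rintro _ ⟨q, hq, t, ht, rfl⟩ _ ⟨q', hq', t', ht', rfl⟩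
        exact ⟨q + q', hadd _ hq _ hq', t + t', by positivity, by rw [add_smul]; abel⟩
      · rintro c hc _ ⟨q, hq, t, ht, rfl⟩
        exact ⟨c • q, hsmul c hc _ hq, c * t, by positivity, by rw [smul_add, smul_smul]⟩
      · rintro f ⟨⟨y, g⟩, hq, t, ht, h⟩
        simp only [Prod.smul_mk, Prod.mk_add_mk, Prod.mk.injEq, smul_neg] at h
        obtain ⟨h1, rfl⟩ := h
        have hy : y = t • x := by rw [eq_comm, add_neg_eq_zero] at h1; exact h1
        subst hy
        have h2 := sle _ _ hq
        rw [← sub_eq_add_neg, sub_nonneg]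
        rcases ht.eq_or_lt with rfl | ht
        · simpa [s_zero] using h2
        · rwa [s_smul t ht] at h2
    have hRR' : R ⊆ R' := fun q hq => ⟨q, hq, 0, le_rfl, by simp⟩
    have hR'R : R' ⊆ R := hmax.le_of_ge hR' hRR'
    have key : ∀ f, ((0 : G), f) ∈ R → s (-x) + s x ≤ f := by
      intro f hf
      have : ((-x, f - s x) : G × F) ∈ R' := ⟨(0, f), hf, 1, zero_le_one, by
        simp [sub_eq_add_neg]⟩
      have := sle _ _ (hR'R this)
      exact le_sub_iff_add_le.1 this
    have h := les _ _ key
    rw [s_zero] at h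
    exact le_neg_iff_add_nonpos_right.2 h
  have s_neg : ∀ x, s (-x) = - s x := by
    intro x
    refine le_antisymm (s_neg_le x) ?_
    have h := s_add x (-x)
    rw [add_neg_cancel, s_zero] at h
    exact neg_le_iff_add_nonneg'.2 h
  refine ⟨{ toFun := s, map_add' := ?_, map_smul' := ?_ }, fun x f hf => sle x f (hsub hf)⟩
  · intro x y
    refine le_antisymm (s_add x y) ?_
    have h := s_add (-x) (-y)
    rw [← neg_add, s_neg, s_neg, s_neg, ← neg_add] at h
    exact neg_le_neg_iff.1 h
  · intro c x
    simp only [RingHom.id_apply]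
    rcases lt_trichotomy c 0 with hc | rfl | hc
    · have h := s_smul (-c) (neg_pos.2 hc) x
      rw [neg_smul, neg_smul, s_neg] at h
      exact neg_injective h
    · simp [s_zero]
    · exact s_smul c hc x

theorem stmt10
    {G : Type*} [Lattice G] [AddCommGroup G] [Module ℝ G]
    [CovariantClass G G (· + ·) (· ≤ ·)] [PosSMulMono ℝ G]
    (arch : ∀ x y : G, (∀ n : ℕ, n • x ≤ y) → x ≤ 0)
    (E : Set G)
    (hE0 : (0 : G) ∈ E)
    (hEadd : ∀ x ∈ E, ∀ y ∈ E, x + y ∈ E)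
    (hEsmul : ∀ (c : ℝ), ∀ x ∈ E, c • x ∈ E)
    (hEsup : ∀ x ∈ E, ∀ y ∈ E, x ⊔ y ∈ E)
    (hEinf : ∀ x ∈ E, ∀ y ∈ E, x ⊓ y ∈ E)
    (hdense : ∀ x : G, 0 < x → ∃ y ∈ E, 0 < y ∧ y ≤ x)
    (hmaj : ∀ x : G, ∃ y ∈ E, x ≤ y)
    {F : Type*} [ConditionallyCompleteLattice F] [AddCommGroup F] [Module ℝ F]
    [CovariantClass F F (· + ·) (· ≤ ·)] [PosSMulMono ℝ F]
    (T : G → F)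
    (hT_add : ∀ x ∈ E, ∀ y ∈ E, T (x + y) = T x + T y)
    (hT_smul : ∀ (c : ℝ), ∀ x ∈ E, T (c • x) = c • T x)
    (hT_ob : ∀ a ∈ E, ∀ b ∈ E, a ≤ b → ∃ c d : F, ∀ x ∈ E, a ≤ x → x ≤ b →
      c ≤ T x ∧ T x ≤ d) :
    ∃ S : G →ₗ[ℝ] F,
      (∀ a b : G, a ≤ b → ∃ c d : F, ∀ x : G, a ≤ x → x ≤ b → c ≤ S x ∧ S x ≤ d) ∧
      ∀ y ∈ E, S y = T y := by
  have : IsOrderedAddMonoid G := by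
    refine ⟨fun a b h c => ?_, fun a b h c => ?_⟩ <;>
    first
    | exact CovariantClass.elim c h
    | (rw [add_comm a, add_comm b]; exact CovariantClass.elim c h)
  have : IsOrderedAddMonoid F := by
    refine ⟨fun a b h c => ?_, fun a b h c => ?_⟩ <;>
    first
    | exact CovariantClass.elim c h
    | (rw [add_comm a, add_comm b]; exact CovariantClass.elim c h)
  have hEneg : ∀ x ∈ E, -x ∈ E := fun x hx => by simpa using hEsmul (-1) x hx
  have hEsub : ∀ x ∈ E, ∀ y ∈ E, x - y ∈ E := fun x hx y hy => by
    rw [sub_eq_add_neg]; exact hEadd _ hx _ (hEneg y hy)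
  have hTneg : ∀ x ∈ E, T (-x) = - T x := fun x hx => by simpa using hT_smul (-1) x hx
  have hT0 : T 0 = 0 := by simpa using hT_smul 0 0 hE0
  let R : Set (G × F) := {p | ∃ e ∈ E, ∃ y ∈ E, ∃ u : F, 0 ≤ y ∧ -y ≤ p.1 - e ∧ p.1 - e ≤ y ∧
    (∀ z ∈ E, -y ≤ z → z ≤ y → T z ≤ u) ∧ p.2 = T e + u}
  have hub : ∀ y ∈ E, 0 ≤ y → ∃ u : F, ∀ z ∈ E, -y ≤ z → z ≤ y → T z ≤ u := by
    intro y hy h0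
    obtain ⟨c, d, h⟩ := hT_ob (-y) (hEneg y hy) y hy ((neg_nonpos.2 h0).trans h0)
    exact ⟨d, fun z hz h1 h2 => (h z hz h1 h2).2⟩
  have hR : GoodCone R := by
    refine ⟨?_, ?_, ?_⟩
    · rintro ⟨x, f⟩ ⟨e, he, y, hy, u, h0, h1, h2, h3, hf⟩ ⟨x', f'⟩
        ⟨e', he', y', hy', u', h0', h1', h2', h3', hf'⟩
      simp only at h1 h2 hf h1' h2' hf'
      refine ⟨e + e', hEadd _ he _ he', y + y', hEadd _ hy _ hy', u + u', add_nonneg h0 h0',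
        ?_, ?_, ?_, ?_⟩
      · simp only [Prod.mk_add_mk]
        rw [neg_add, add_sub_add_comm]; exact add_le_add h1 h1'
      · simp only [Prod.mk_add_mk]
        rw [add_sub_add_comm]; exact add_le_add h2 h2'
      · intro z hz hz1 hz2
        have hw : (z ⊓ y) ⊔ (-y) ∈ E := hEsup _ (hEinf _ hz _ hy) _ (hEneg _ hy)
        have hw1 : -y ≤ (z ⊓ y) ⊔ (-y) := le_sup_right
        have hw2 : (z ⊓ y) ⊔ (-y) ≤ y := sup_le inf_le_right ((neg_nonpos.2 h0).trans h0)
        have hw3 : (z ⊓ y) ⊔ (-y) ≤ z + y' := by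
          refine sup_le (inf_le_left.trans (le_add_of_nonneg_right h0')) ?_
          rw [neg_add, ← sub_eq_add_neg] at hz1
          exact sub_le_iff_le_add.1 hz1
        have hw4 : z - y' ≤ (z ⊓ y) ⊔ (-y) := by
          refine le_trans (le_inf (sub_le_self _ h0') ?_) le_sup_left
          exact sub_le_iff_le_add.2 hz2
        generalize (z ⊓ y) ⊔ (-y) = w at *
        have hz' : z = w + (z - w) := by abel
        have hzw := hEsub _ hz _ hw
        rw [hz', hT_add _ hw _ hzw]
        refine add_le_add (h3 _ hw hw1 hw2) (h3' _ hzw ?_ ?_)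
        · rw [neg_le_sub_iff_le_add]; exact hw3
        · exact sub_le_comm.1 hw4
      · simp only [Prod.mk_add_mk]
        rw [hf, hf', hT_add _ he _ he', add_add_add_comm]
    · rintro c hc ⟨x, f⟩ ⟨e, he, y, hy, u, h0, h1, h2, h3, hf⟩
      simp only at h1 h2 hf
      refine ⟨c • e, hEsmul _ _ he, c • y, hEsmul _ _ hy, c • u, smul_nonneg hc.le h0, ?_, ?_, ?_, ?_⟩
      · simp only [Prod.smul_mk]
        rw [← smul_neg, ← smul_sub]; exact smul_le_smul_of_nonneg_left h1 hc.le
      · simp only [Prod.smul_mk]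
        rw [← smul_sub]; exact smul_le_smul_of_nonneg_left h2 hc.le
      · intro z hz hz1 hz2
        have hc' := (inv_pos.2 hc).le
        have a1 := smul_le_smul_of_nonneg_left hz1 hc'
        have a2 := smul_le_smul_of_nonneg_left hz2 hc'
        rw [smul_neg, smul_smul, inv_mul_cancel₀ hc.ne', one_smul] at a1
        rw [smul_smul, inv_mul_cancel₀ hc.ne', one_smul] at a2
        have a3 := smul_le_smul_of_nonneg_left (h3 _ (hEsmul c⁻¹ _ hz) a1 a2) hc.le
        rwa [hT_smul _ _ hz, smul_smul, mul_inv_cancel₀ hc.ne', one_smul] at a3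
      · simp only [Prod.smul_mk]
        rw [hf, hT_smul _ _ he, smul_add]
    · rintro f ⟨e, he, y, hy, u, h0, h1, h2, h3, hf⟩
      simp only [zero_sub] at h1 h2 hf
      have h := h3 _ (hEneg _ he) h1 h2
      rw [hTneg _ he] at h
      rw [hf]
      exact neg_le_iff_add_nonneg'.1 h
  have hmem : ∀ x : G, ∀ y ∈ E, 0 ≤ y → -y ≤ x → x ≤ y → ∀ u : F,
      (∀ z ∈ E, -y ≤ z → z ≤ y → T z ≤ u) → (x, u) ∈ R := by
    intro x y hy h0 h1 h2 u hu
    exact ⟨0, hE0, y, hy, u, h0, by simpa using h1, by simpa using h2, hu, by simp [hT0]⟩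
  have hmaj' : ∀ a b : G, ∃ y ∈ E, 0 ≤ y ∧ -y ≤ a ∧ b ≤ y := by
    intro a b
    obtain ⟨y, hy, h⟩ := hmaj ((-a ⊔ b) ⊔ 0)
    exact ⟨y, hy, le_sup_right.trans h,
      neg_le.1 ((le_sup_left.trans le_sup_left).trans h), (le_sup_right.trans le_sup_left).trans h⟩
  obtain ⟨S, hS⟩ := goodCone_extension R hR (by
    intro x
    obtain ⟨y, hy, h0, h1, h2⟩ := hmaj' x x
    obtain ⟨u, hu⟩ := hub y hy h0
    exact ⟨u, hmem x y hy h0 h1 h2 u hu⟩)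
  refine ⟨S, ?_, ?_⟩
  · intro a b _
    obtain ⟨y, hy, h0, h1, h2⟩ := hmaj' a b
    obtain ⟨u, hu⟩ := hub y hy h0
    refine ⟨-u, u, fun x hax hxb => ⟨?_, ?_⟩⟩
    · have h := hS _ _ (hmem (-x) y hy h0 (neg_le_neg (hxb.trans h2))
        (neg_le.1 (h1.trans hax)) u hu)
      rw [map_neg] at h
      exact neg_le.1 h
    · exact hS _ _ (hmem x y hy h0 (h1.trans hax) (hxb.trans h2) u hu)
  · have hle : ∀ y ∈ E, S y ≤ T y := by
      intro y hy
      refine hS _ _ ⟨y, hy, 0, hE0, 0, le_rfl, by simp, by simp, ?_, by simp⟩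
      intro z hz h1 h2
      have : z = 0 := le_antisymm h2 (by simpa using h1)
      rw [this, hT0]
    intro y hy
    refine le_antisymm (hle y hy) ?_
    have h := hle _ (hEneg y hy)
    rw [map_neg, hTneg _ hy] at h
    exact neg_le_neg_iff.1 h
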